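/- arXiv:math/0612750 — 3 statements merged into one kernel-verified Lean document; each statement's English description precedes it below -/
import Mathlib

section
/- The weighted Hardy estimate fails for the weight exponent f = 1: for every constant C > 0 there exists a smooth function v : ℝ → ℝ with compact support contained in (0,1) such that ∫_{(0,1)} x^{-1} v(x)^2 dx > C · ∫_{(0,1)} x · (v'(x)^2 + v(x)^2) dx. -/
open MeasureTheory Set

lemma aux_cov (F : ℝ → ℝ) (hF : ∀ x, x ∉ Ioo (0:ℝ) 1 → F x = 0) :
    ∫ x in Ioo (0:ℝ) 1, F x = ∫ t, Real.exp t * F (Real.exp t) := by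
  have h1 : ∫ x in Ioo (0:ℝ) 1, F x = ∫ x in Ioi (0:ℝ), F x := by
    refine (setIntegral_eq_of_subset_of_forall_sdiff_eq_zero measurableSet_Ioi
      Ioo_subset_Ioi_self ?_).symm
    intro x hx
    exact hF x hx.2
  have h2 := integral_image_eq_integral_abs_deriv_smul (s := univ) (f := Real.exp)
    (f' := Real.exp) MeasurableSet.univ
    (fun x _ => (Real.hasDerivAt_exp x).hasDerivWithinAt) (Real.exp_injective.injOn) F
  rw [image_univ, Real.range_exp] at h2
  rw [h1, h2, setIntegral_univ]
  simp [abs_of_pos (Real.exp_pos _)]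

lemma aux_scale (g : ℝ → ℝ) (R : ℝ) (hR : 0 < R) :
    ∫ t, g (t / R + 3) = R * ∫ s, g s := by
  have := Measure.integral_comp_div (fun s => g (s + 3)) R
  rw [this, integral_add_right_eq_self g 3, abs_of_pos hR, smul_eq_mul]

lemma aux_cs (f : ℝ → ℝ) (hc : HasCompactSupport f) :
    HasCompactSupport (fun s => f s ^ 2) :=
  hc.mono (fun x hx h => hx (by simp [h]))

lemma aux_ct (f : ℝ → ℝ) (hf : Continuous f) : Continuous (fun s => f s ^ 2) := by
  fun_prop

lemma aux_int (f : ℝ → ℝ) (hf : Continuous f) (hc : HasCompactSupport f) :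
    Integrable (fun s => f s ^ 2) :=
  (aux_ct f hf).integrable_of_hasCompactSupport (aux_cs f hc)

lemma aux_pos (f : ℝ → ℝ) (hf : Continuous f) (hc : HasCompactSupport f) (h0 : f 0 ≠ 0) :
    0 < ∫ s, f s ^ 2 :=
  (aux_ct f hf).integral_pos_of_hasCompactSupport_nonneg_nonzero (aux_cs f hc)
    (fun s => sq_nonneg (f s)) (x := 0) (pow_ne_zero 2 h0)

set_option maxHeartbeats 400000 in
/-- Failure of the weighted Hardy estimate for weight exponent `f = 1`:
`‖x⁻¹ v‖_{L²(x dx)}` is not controlled by the form-domain norm. -/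
theorem hardy_fails_for_f_eq_one :
    ∀ C : ℝ, 0 < C →
      ∃ v : ℝ → ℝ, ContDiff ℝ (⊤ : ℕ∞) v ∧ HasCompactSupport v ∧
        tsupport v ⊆ Ioo (0:ℝ) 1 ∧
        C * ∫ x in Ioo (0:ℝ) 1, x * ((deriv v x) ^ 2 + (v x) ^ 2) <
          ∫ x in Ioo (0:ℝ) 1, x⁻¹ * (v x) ^ 2 := by
  intro C hC
  obtain ⟨ψ, hψ, hψc, hψ0, hψs⟩ : ∃ ψ : ℝ → ℝ, ContDiff ℝ (⊤ : ℕ∞) ψ ∧ HasCompactSupport ψ ∧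
      ψ 0 ≠ 0 ∧ ∀ s, ψ s ≠ 0 → -2 < s ∧ s < 2 := by
    let B : ContDiffBump (0:ℝ) := ⟨1, 2, one_pos, one_lt_two⟩
    refine ⟨B, B.contDiff, B.hasCompactSupport, ?_, ?_⟩
    · have : B 0 = 1 := B.one_of_mem_closedBall (by simp [B])
      rw [this]; exact one_ne_zero
    · intro s hs
      have : s ∈ Function.support B := hs
      rw [B.support_eq, Real.ball_eq_Ioo] at this
      simpa [B] using this
  have hψd : Continuous (deriv ψ) := hψ.continuous_deriv (by simp)
  have hi1 : Integrable (fun s => ψ s ^ 2) := aux_int ψ hψ.continuous hψc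
  have hi2 : Integrable (fun s => deriv ψ s ^ 2) := aux_int _ hψd hψc.deriv
  set a := ∫ s, ψ s ^ 2 with ha
  set b := ∫ s, deriv ψ s ^ 2 with hb
  have ha0 : 0 < a := aux_pos ψ hψ.continuous hψc hψ0
  have hb0 : 0 ≤ b := integral_nonneg (fun s => sq_nonneg _)
  obtain ⟨R, hR1, hR⟩ : ∃ R : ℝ, 1 ≤ R ∧ C * (a + b) < R * a := by
    refine ⟨1 + C * (a + b) / a, ?_, ?_⟩
    · have : 0 ≤ C * (a + b) / a := by positivity
      linarith
    · rw [add_mul, div_mul_cancel₀ _ ha0.ne']; linarith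
  have hR0 : 0 < R := by linarith
  let v : ℝ → ℝ := fun x => if 0 < x then ψ (Real.log x / R + 3) else 0
  have hvpos : ∀ x, 0 < x → v x = ψ (Real.log x / R + 3) := fun x hx => by simp [v, hx]
  have hvs : ∀ x, v x ≠ 0 → x ∈ Icc (Real.exp (-5 * R)) (Real.exp (-R)) := by
    intro x hx
    by_cases h : 0 < x
    · rw [hvpos x h] at hx
      obtain ⟨h1, h2⟩ := hψs _ hx
      have h3 : -5 < Real.log x / R := by linarith
      have h4 : Real.log x / R < -1 := by linarith
      rw [lt_div_iff₀ hR0] at h3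
      rw [div_lt_iff₀ hR0] at h4
      constructor
      · rw [← Real.le_log_iff_exp_le h]; exact h3.le
      · rw [← Real.log_le_iff_le_exp h]; linarith
    · simp [v, h] at hx
  have hts : tsupport v ⊆ Icc (Real.exp (-5 * R)) (Real.exp (-R)) :=
    closure_minimal (fun x hx => hvs x hx) isClosed_Icc
  have hIcc : Icc (Real.exp (-5 * R)) (Real.exp (-R)) ⊆ Ioo (0:ℝ) 1 := by
    intro x hx
    refine ⟨(Real.exp_pos _).trans_le hx.1, hx.2.trans_lt ?_⟩
    rw [Real.exp_lt_one_iff]; linarith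
  have hts' := hts.trans hIcc
  have hv0 : ∀ x, x ∉ Ioo (0:ℝ) 1 → v x = 0 := fun x hx =>
    image_eq_zero_of_notMem_tsupport (fun h => hx (hts' h))
  have hdv0 : ∀ x, x ∉ Ioo (0:ℝ) 1 → deriv v x = 0 := fun x hx => by
    by_contra h
    exact hx (hts' (support_deriv_subset h))
  have hvexp : ∀ t, v (Real.exp t) = ψ (t / R + 3) := fun t => by
    rw [hvpos _ (Real.exp_pos t), Real.log_exp]
  have hdexp : ∀ t, deriv v (Real.exp t) = deriv ψ (t / R + 3) * ((Real.exp t)⁻¹ / R) := by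
    intro t
    have h1 : v =ᶠ[nhds (Real.exp t)] fun x => ψ (Real.log x / R + 3) := by
      filter_upwards [lt_mem_nhds (Real.exp_pos t)] with x hx using hvpos x hx
    rw [h1.deriv_eq]
    have h2 : HasDerivAt (fun x => Real.log x / R + 3) ((Real.exp t)⁻¹ / R) (Real.exp t) :=
      ((Real.hasDerivAt_log (Real.exp_pos t).ne').div_const R).add_const 3
    have h3 : HasDerivAt ψ (deriv ψ (t / R + 3)) (Real.log (Real.exp t) / R + 3) := by
      rw [Real.log_exp]
      exact ((hψ.differentiable (by simp)) _).hasDerivAt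
    exact (h3.comp (Real.exp t) h2).deriv
  refine ⟨v, ?_, ?_, hts', ?_⟩
  · rw [contDiff_iff_contDiffAt]
    intro x
    by_cases h : 0 < x
    · have h1 : v =ᶠ[nhds x] fun x => ψ (Real.log x / R + 3) := by
        filter_upwards [lt_mem_nhds h] with x hx using hvpos x hx
      refine ContDiffAt.congr_of_eventuallyEq ?_ h1
      exact hψ.contDiffAt.comp x
        (((Real.contDiffAt_log.2 h.ne').div_const R).add contDiffAt_const)
    · have h1 : v =ᶠ[nhds x] fun _ => 0 :=
        notMem_tsupport_iff_eventuallyEq.1 (fun h' => h (hts' h').1)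
      exact contDiffAt_const.congr_of_eventuallyEq h1
  · exact isCompact_Icc.of_isClosed_subset (isClosed_tsupport v) hts
  · rw [aux_cov _ (fun x hx => by simp [hv0 x hx, hdv0 x hx]),
      aux_cov _ (fun x hx => by simp [hv0 x hx])]
    have e1 : ∫ t, Real.exp t * ((Real.exp t)⁻¹ * v (Real.exp t) ^ 2) = R * a := by
      rw [ha, ← aux_scale (fun s => ψ s ^ 2) R hR0]
      congr 1; ext t
      rw [hvexp, mul_inv_cancel_left₀ (Real.exp_pos t).ne']
    rw [e1]
    have hi3 : Integrable (fun s => (R ^ 2)⁻¹ * (deriv ψ s ^ 2 + ψ s ^ 2)) :=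
      (hi2.add hi1).const_mul _
    have e2 : ∫ t, Real.exp t * (Real.exp t *
        (deriv v (Real.exp t) ^ 2 + v (Real.exp t) ^ 2)) ≤ R * ((R ^ 2)⁻¹ * (b + a)) := by
      have e3 : ∫ s, (R ^ 2)⁻¹ * (deriv ψ s ^ 2 + ψ s ^ 2) = (R ^ 2)⁻¹ * (b + a) := by
        rw [integral_const_mul, integral_add hi2 hi1]
      rw [← e3, ← aux_scale (fun s => (R ^ 2)⁻¹ * (deriv ψ s ^ 2 + ψ s ^ 2)) R hR0]
      refine integral_mono_of_nonneg (Filter.Eventually.of_forall fun t => ?_) ?_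
        (Filter.Eventually.of_forall fun t => ?_)
      · simp only [Pi.zero_apply]; positivity
      · exact (hi3.comp_add_right 3).comp_div hR0.ne'
      · simp only
        rw [hvexp, hdexp]
        have hE := Real.exp_pos t
        have k : Real.exp t * (Real.exp t * ((deriv ψ (t / R + 3) * ((Real.exp t)⁻¹ / R)) ^ 2
            + ψ (t / R + 3) ^ 2)) = (R ^ 2)⁻¹ * deriv ψ (t / R + 3) ^ 2
              + Real.exp t ^ 2 * ψ (t / R + 3) ^ 2 := by
          field_simp
        rw [k, mul_add]
        refine add_le_add le_rfl ?_
        by_cases h : ψ (t / R + 3) = 0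
        · simp [h]
        · have h2 := (hvs (Real.exp t) (by rwa [hvexp])).2
          have h3 : Real.exp (-R) ≤ R⁻¹ := by
            rw [Real.exp_neg]
            exact inv_anti₀ hR0 (by linarith [Real.add_one_le_exp R])
          rw [← inv_pow]
          have := h2.trans h3
          gcongr
    calc _ ≤ C * (R * ((R ^ 2)⁻¹ * (b + a))) := by gcongr
      _ = C * (a + b) / R := by field_simp; ring
      _ < R * a := by
        rw [div_lt_iff₀ hR0]
        nlinarith [mul_pos hR0 ha0]
end

section
/- Let k, l ≥ 1 be natural numbers, let u : ℝ^k × ℝ^l → ℂ be measurable (write points as (η,ζ)), let s > m be real numbers and N ≥ 0 a real number. Assume that ∫ (1+|η|²+|ζ|²)^s |u(η,ζ)|² dη dζ < ∞ and ∫ (1+|η|²+|ζ|²)^m (1+|ζ|²)^N |u(η,ζ)|² dη dζ < ∞. Then for every ε with 0 < ε ≤ s−m and every real κ with 0 ≤ κ ≤ Nε/(s−m), one has ∫ (1+|η|²+|ζ|²)^{s−ε} (1+|ζ|²)^{κ} |u(η,ζ)|² dη dζ < ∞. -/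
open MeasureTheory

theorem weight_interp (A B s m N ε κ : ℝ) (hA : 1 ≤ A) (hB : 1 ≤ B) (hsm : m < s)
    (hε : 0 < ε) (hεsm : ε ≤ s - m) (hκ : κ ≤ N * ε / (s - m)) :
    A ^ (s - ε) * B ^ κ ≤ A ^ s + A ^ m * B ^ N := by
  have hd : 0 < s - m := by linarith
  have hA0 : 0 < A := by linarith
  have hB0 : 0 < B := by linarith
  obtain ⟨θ, hθ⟩ : ∃ θ, θ = ε / (s - m) := ⟨_, rfl⟩
  have hθ0 : 0 ≤ θ := by rw [hθ]; positivity
  have hθ1 : θ ≤ 1 := by rw [hθ, div_le_one hd]; exact hεsm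
  have hεθ : ε = θ * (s - m) := by rw [hθ]; field_simp
  have hκ' : κ ≤ N * θ := by rw [hθ, ← mul_div_assoc]; exact hκ
  have hX : 0 ≤ A ^ s := by positivity
  have hY : 0 ≤ A ^ m * B ^ N := by positivity
  have key := Real.geom_mean_le_arith_mean2_weighted (sub_nonneg.2 hθ1) hθ0 hX hY (by ring)
  have e : (A ^ s) ^ (1 - θ) * (A ^ m * B ^ N) ^ θ = A ^ (s - ε) * B ^ (N * θ) := by
    rw [Real.mul_rpow (by positivity) (by positivity), ← Real.rpow_mul hA0.le,
      ← Real.rpow_mul hA0.le, ← Real.rpow_mul hB0.le, ← mul_assoc, ← Real.rpow_add hA0]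
    congr 2
    rw [hεθ]; ring
  rw [e] at key
  have h3 : A ^ (s - ε) * B ^ κ ≤ A ^ (s - ε) * B ^ (N * θ) :=
    mul_le_mul_of_nonneg_left (Real.rpow_le_rpow_of_exponent_le hB hκ') (by positivity)
  nlinarith [mul_nonneg hθ0 hX, mul_nonneg (sub_nonneg.2 hθ1) hY]

/-- Interpolation of coisotropic regularity (Fourier-transform side):
if `u` is in `H^s` and coisotropic of order `N` relative to `H^m` with `s > m`,
then `u` is coisotropic of order `κ ≤ Nε/(s−m)` relative to `H^{s−ε}`. -/
theorem coisotropic_interpolation (k l : ℕ) (hk : 1 ≤ k) (hl : 1 ≤ l)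
    (u : EuclideanSpace ℝ (Fin k) × EuclideanSpace ℝ (Fin l) → ℂ)
    (hu : Measurable u) (s m N : ℝ) (hsm : m < s) (hN : 0 ≤ N)
    (h1 : ∫⁻ p : EuclideanSpace ℝ (Fin k) × EuclideanSpace ℝ (Fin l),
        ENNReal.ofReal ((1 + ‖p.1‖ ^ 2 + ‖p.2‖ ^ 2) ^ s * ‖u p‖ ^ 2) < ⊤)
    (h2 : ∫⁻ p : EuclideanSpace ℝ (Fin k) × EuclideanSpace ℝ (Fin l),
        ENNReal.ofReal ((1 + ‖p.1‖ ^ 2 + ‖p.2‖ ^ 2) ^ m * (1 + ‖p.2‖ ^ 2) ^ N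
          * ‖u p‖ ^ 2) < ⊤)
    (ε κ : ℝ) (hε : 0 < ε) (hεsm : ε ≤ s - m) (hκ0 : 0 ≤ κ)
    (hκ : κ ≤ N * ε / (s - m)) :
    ∫⁻ p : EuclideanSpace ℝ (Fin k) × EuclideanSpace ℝ (Fin l),
        ENNReal.ofReal ((1 + ‖p.1‖ ^ 2 + ‖p.2‖ ^ 2) ^ (s - ε) * (1 + ‖p.2‖ ^ 2) ^ κ
          * ‖u p‖ ^ 2) < ⊤ := by
  refine lt_of_le_of_lt (lintegral_mono (g := fun p =>
    ENNReal.ofReal ((1 + ‖p.1‖ ^ 2 + ‖p.2‖ ^ 2) ^ s * ‖u p‖ ^ 2) +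
    ENNReal.ofReal ((1 + ‖p.1‖ ^ 2 + ‖p.2‖ ^ 2) ^ m * (1 + ‖p.2‖ ^ 2) ^ N * ‖u p‖ ^ 2)) ?_) ?_
  · intro p
    dsimp only
    rw [← ENNReal.ofReal_add (by positivity) (by positivity), ← add_mul]
    apply ENNReal.ofReal_le_ofReal
    refine mul_le_mul_of_nonneg_right ?_ (by positivity)
    exact weight_interp _ _ s m N ε κ (by nlinarith [sq_nonneg ‖p.1‖, sq_nonneg ‖p.2‖])
      (by nlinarith [sq_nonneg ‖p.2‖]) hsm hε hεsm hκ
  · rw [lintegral_add_left (by fun_prop)]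
    exact ENNReal.add_lt_top.2 ⟨h1, h2⟩
end

section
/- Let k, l ≥ 1 be natural numbers, let u : ℝ^k × ℝ^l → ℂ be measurable (write points as (η,ζ)), let r, β ∈ ℝ and K ≥ 0 a real number. Assume that (i) ∫ (1+|η|²+|ζ|²)^{r} (1+|ζ|²)^{-K} |u(η,ζ)|² dη dζ < ∞, and (ii) for every real N ≥ 0, ∫ (1+|η|²+|ζ|²)^{β} (1+|ζ|²)^{N} |u(η,ζ)|² dη dζ < ∞. Then for every r′ < r one has ∫ (1+|η|²+|ζ|²)^{r′} |u(η,ζ)|² dη dζ < ∞. -/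
open MeasureTheory

lemma interp_pointwise (A B r r' β K : ℝ) (hA : 1 ≤ A) (hB : 1 ≤ B) (h : r' < r) :
    A ^ r' ≤ A ^ r * B ^ (-K) + A ^ β * B ^ (|r' - β| * (K / (r - r'))) := by
  have hA0 : 0 < A := by linarith
  have hB0 : 0 < B := by linarith
  have hd : 0 < r - r' := by linarith
  have p1 : 0 < A ^ r * B ^ (-K) := by positivity
  have p2 : 0 < A ^ β * B ^ (|r' - β| * (K / (r - r'))) := by positivity
  rcases le_total (B ^ K) (A ^ (r - r')) with hc | hc
  · have : A ^ r' ≤ A ^ r * B ^ (-K) := by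
      rw [Real.rpow_neg hB0.le, ← div_eq_mul_inv, le_div_iff₀ (by positivity)]
      calc A ^ r' * B ^ K ≤ A ^ r' * A ^ (r - r') := by gcongr
        _ = A ^ r := by rw [← Real.rpow_add hA0]; congr 1; ring
    linarith
  · have h1 : A ≤ B ^ (K / (r - r')) := by
      have := Real.rpow_le_rpow (by positivity) hc (inv_nonneg.2 hd.le)
      rwa [← Real.rpow_mul hA0.le, ← Real.rpow_mul hB0.le, mul_inv_cancel₀ hd.ne',
        Real.rpow_one, ← div_eq_mul_inv] at this
    have h2 : A ^ (r' - β) ≤ B ^ (|r' - β| * (K / (r - r'))) := by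
      calc A ^ (r' - β) ≤ A ^ |r' - β| := Real.rpow_le_rpow_of_exponent_le hA (le_abs_self _)
        _ ≤ (B ^ (K / (r - r'))) ^ |r' - β| := Real.rpow_le_rpow hA0.le h1 (abs_nonneg _)
        _ = _ := by rw [← Real.rpow_mul hB0.le, mul_comm]
    have : A ^ r' ≤ A ^ β * B ^ (|r' - β| * (K / (r - r'))) := by
      calc A ^ r' = A ^ β * A ^ (r' - β) := by rw [← Real.rpow_add hA0]; congr 1; ring
        _ ≤ _ := by gcongr
    linarith

/-- Interpolation step in the proof of the geometric theorem:
nonfocusing of degree `K` relative to `H^r` together with infinite-order coisotropic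
regularity relative to some background space `H^β` implies membership in `H^{r-0}`. -/
theorem nonfocusing_interpolation (k l : ℕ) (hk : 1 ≤ k) (hl : 1 ≤ l)
    (u : EuclideanSpace ℝ (Fin k) × EuclideanSpace ℝ (Fin l) → ℂ)
    (hu : Measurable u) (r β K : ℝ) (hK : 0 ≤ K)
    (h1 : ∫⁻ p : EuclideanSpace ℝ (Fin k) × EuclideanSpace ℝ (Fin l),
        ENNReal.ofReal ((1 + ‖p.1‖ ^ 2 + ‖p.2‖ ^ 2) ^ r * (1 + ‖p.2‖ ^ 2) ^ (-K)
          * ‖u p‖ ^ 2) < ⊤)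
    (h2 : ∀ N : ℝ, 0 ≤ N →
        ∫⁻ p : EuclideanSpace ℝ (Fin k) × EuclideanSpace ℝ (Fin l),
          ENNReal.ofReal ((1 + ‖p.1‖ ^ 2 + ‖p.2‖ ^ 2) ^ β * (1 + ‖p.2‖ ^ 2) ^ N
            * ‖u p‖ ^ 2) < ⊤) :
    ∀ r' : ℝ, r' < r →
      ∫⁻ p : EuclideanSpace ℝ (Fin k) × EuclideanSpace ℝ (Fin l),
        ENNReal.ofReal ((1 + ‖p.1‖ ^ 2 + ‖p.2‖ ^ 2) ^ r' * ‖u p‖ ^ 2) < ⊤ := by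
  intro r' hr
  have hN : 0 ≤ |r' - β| * (K / (r - r')) :=
    mul_nonneg (abs_nonneg _) (div_nonneg hK (by linarith))
  refine lt_of_le_of_lt ?_ (ENNReal.add_lt_top.2 ⟨h1, h2 _ hN⟩)
  rw [← lintegral_add_left (by fun_prop)]
  refine lintegral_mono fun p => ?_
  rw [← ENNReal.ofReal_add (by positivity) (by positivity), ← add_mul]
  apply ENNReal.ofReal_le_ofReal
  refine mul_le_mul_of_nonneg_right ?_ (by positivity)
  exact interp_pointwise _ _ r r' β K (by nlinarith [sq_nonneg ‖p.1‖, sq_nonneg ‖p.2‖])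
    (by nlinarith [sq_nonneg ‖p.2‖]) hr
end
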